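/- In the first-price auction with value v > 0, no action is loss-averse: for every bid b ∈ [0,v] there exists another bid b' ∈ [0,v] such that inf over η ∈ D(b,b') of u(b,η) is strictly less than inf over η ∈ D(b,b') of u(b',η). -/

import Mathlib

/-- The set of nature states on which two actions `a`, `a'` give different utilities. -/
def diffStates {A N : Type*} (u : A → N → ℝ) (a a' : A) : Set N :=
  {η | u a η ≠ u a' η}

/-- The infimum (in the extended reals, so that the infimum over the empty set is `+∞`)
of the utility of action `c` over a set `s` of nature states. -/
noncomputable def infOn {A N : Type*} (u : A → N → ℝ) (c : A) (s : Set N) : EReal :=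
  ⨅ η ∈ s, (u c η : EReal)

/-- First-price auction with value `v`, from a single agent's perspective: actions are
bids `b ∈ [0,v]`, nature states are competing bids `β ∈ [0,v]`, the agent wins iff `b > β`
(ties go to nature), and the utility is `v - b` upon winning and `0` otherwise. -/
noncomputable def fpaU (v : ℝ) (b β : Set.Icc (0 : ℝ) v) : ℝ :=
  if (β : ℝ) < (b : ℝ) then v - (b : ℝ) else 0

theorem infOn_lt_infOn {A N : Type*} {u : A → N → ℝ} {a a' : A} {s : Set N} {η : N} {c : ℝ}
    (hη : η ∈ s) (hlt : u a η < c) (hle : ∀ x ∈ s, c ≤ u a' x) :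
    infOn u a s < infOn u a' s :=
  calc infOn u a s ≤ (u a η : EReal) := iInf₂_le η hη
    _ < (c : EReal) := EReal.coe_lt_coe_iff.2 hlt
    _ ≤ infOn u a' s := le_iInf₂ fun x hx => EReal.coe_le_coe_iff.2 (hle x hx)

theorem fpaU_of_lt {v : ℝ} {b β : Set.Icc (0 : ℝ) v} (h : (β : ℝ) < b) :
    fpaU v b β = v - b :=
  if_pos h

theorem fpaU_of_le {v : ℝ} {b β : Set.Icc (0 : ℝ) v} (h : (b : ℝ) ≤ β) :
    fpaU v b β = 0 :=
  if_neg h.not_gt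

/-- A bid equal to the value never yields a nonzero utility. -/
theorem fpaU_of_eq {v : ℝ} {b : Set.Icc (0 : ℝ) v} (h : (b : ℝ) = v) (β : Set.Icc (0 : ℝ) v) :
    fpaU v b β = 0 := by
  simp [fpaU, h]

/-- If `b' < v` wins against `η`, while `b` gains nothing against `η` nor against any
competing bid that defeats `b'`, then `b'` has the larger infimum on the states where the
two bids differ. -/
theorem infOn_fpaU_lt {v : ℝ} {b b' η : Set.Icc (0 : ℝ) v} (hb' : (b' : ℝ) < v)
    (hη : (η : ℝ) < b') (hbη : fpaU v b η = 0)
    (hb : ∀ β : Set.Icc (0 : ℝ) v, (b' : ℝ) ≤ β → fpaU v b β = 0) :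
    infOn (fpaU v) b (diffStates (fpaU v) b b') <
      infOn (fpaU v) b' (diffStates (fpaU v) b b') := by
  refine infOn_lt_infOn (η := η) (c := v - b') ?_ ?_ fun β hβ => ?_
  · change fpaU v b η ≠ fpaU v b' η
    rw [hbη, fpaU_of_lt hη]
    exact (sub_pos.2 hb').ne
  · rw [hbη]
    exact sub_pos.2 hb'
  · rcases lt_or_ge (β : ℝ) b' with h | h
    · exact (fpaU_of_lt h).ge
    · exact absurd ((hb β h).trans (fpaU_of_le h).symm) hβ

/-- in the first-price auction with value `v > 0`, no bid is loss-averse: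
for every bid `b ∈ [0,v]` there is another bid `b' ∈ [0,v]` such that the infimum of
`u(b,·)` over the states where the two bids' utilities differ is strictly smaller than
the corresponding infimum for `b'`. -/
theorem fpa_no_lossAverse (v : ℝ) (hv : 0 < v) (b : Set.Icc (0 : ℝ) v) :
    ∃ b' : Set.Icc (0 : ℝ) v,
      infOn (fpaU v) b (diffStates (fpaU v) b b') <
        infOn (fpaU v) b' (diffStates (fpaU v) b b') := by
  rcases b.2.2.eq_or_lt with h | h
  · exact ⟨⟨v / 2, by constructor <;> linarith⟩,
      infOn_fpaU_lt (η := ⟨0, le_rfl, hv.le⟩) (half_lt_self hv) (half_pos hv)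
        (fpaU_of_eq h _) fun β _ => fpaU_of_eq h β⟩
  · have hb := b.2.1
    have hlt : (b : ℝ) < (b + v) / 2 := by linarith
    exact ⟨⟨(b + v) / 2, by constructor <;> linarith⟩,
      infOn_fpaU_lt (η := b) (add_div_two_lt_right.2 h) hlt (fpaU_of_le le_rfl)
        fun β hβ => fpaU_of_le (hlt.le.trans hβ)⟩
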